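/- arXiv:1807.05112 — 2 statements merged into one kernel-verified Lean document; each statement's English description precedes it below -/
import Mathlib

section
/- For every τ ∈ {1,…,T}: if x^U_τ ≥ 1 then ΔĈ^L_τ(x^U_τ) := Ĉ^L_τ(x^U_τ) − Ĉ^L_τ(x^U_τ − 1) ≤ β, and if x^U_τ + 1 ≤ m then ΔĈ^L_τ(x^U_τ + 1) := Ĉ^L_τ(x^U_τ + 1) − Ĉ^L_τ(x^U_τ) ≥ β. Consequently, ΔĈ^L_τ(x) ≤ β for all 1 ≤ x ≤ x^U_τ. -/
open Finset

noncomputable section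

/-- Feasibility of a (truncated) schedule for time horizon `τ` with `m` servers:
`x 0 = 0` and `x t ∈ {0, …, m}` for `t ∈ {1, …, τ}`. -/
def Feas (τ m : ℕ) (x : ℕ → ℕ) : Prop :=
  x 0 = 0 ∧ ∀ t ∈ Finset.Icc 1 τ, x t ≤ m

/-- `C^L_τ(X) = ∑_{t=1}^τ f_t(x_t) + β ∑_{t=1}^τ (x_t − x_{t−1})⁺`
(switching cost charged for powering up). -/
def CL (τ : ℕ) (β : ℝ) (f : ℕ → ℕ → ℝ) (x : ℕ → ℕ) : ℝ :=
  ∑ t ∈ Finset.Icc 1 τ, f t (x t)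
    + β * ∑ t ∈ Finset.Icc 1 τ, max ((x t : ℝ) - (x (t - 1) : ℝ)) 0

/-- `C^U_τ(X) = ∑_{t=1}^τ f_t(x_t) + β ∑_{t=1}^τ (x_{t−1} − x_t)⁺`
(switching cost charged for powering down). -/
def CU (τ : ℕ) (β : ℝ) (f : ℕ → ℕ → ℝ) (x : ℕ → ℕ) : ℝ :=
  ∑ t ∈ Finset.Icc 1 τ, f t (x t)
    + β * ∑ t ∈ Finset.Icc 1 τ, max ((x (t - 1) : ℝ) - (x t : ℝ)) 0

/-- The set of final states `x τ` of minimizers of `C^L_τ`. -/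
def FinalL (τ m : ℕ) (β : ℝ) (f : ℕ → ℕ → ℝ) : Set ℕ :=
  {n | ∃ x : ℕ → ℕ, Feas τ m x ∧ x τ = n ∧
    ∀ y : ℕ → ℕ, Feas τ m y → CL τ β f x ≤ CL τ β f y}

/-- The set of final states `x τ` of minimizers of `C^U_τ`. -/
def FinalU (τ m : ℕ) (β : ℝ) (f : ℕ → ℕ → ℝ) : Set ℕ :=
  {n | ∃ x : ℕ → ℕ, Feas τ m x ∧ x τ = n ∧
    ∀ y : ℕ → ℕ, Feas τ m y → CU τ β f x ≤ CU τ β f y}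

/-- `Ĉ^L_τ(n)`: the minimal value of `C^L_τ` over feasible schedules whose final
state is `n`. -/
def hatCL (τ m : ℕ) (β : ℝ) (f : ℕ → ℕ → ℝ) (n : ℕ) : ℝ :=
  sInf {c : ℝ | ∃ x : ℕ → ℕ, Feas τ m x ∧ x τ = n ∧ c = CL τ β f x}

/-- `Ĉ^U_τ(n)`: the minimal value of `C^U_τ` over feasible schedules whose final
state is `n`. -/
def hatCU (τ m : ℕ) (β : ℝ) (f : ℕ → ℕ → ℝ) (n : ℕ) : ℝ :=
  sInf {c : ℝ | ∃ x : ℕ → ℕ, Feas τ m x ∧ x τ = n ∧ c = CU τ β f x}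

/-- For a schedule starting at `0`, the two cost functions differ by `β` times the final state. -/
theorem CL_eq_CU_add (τ : ℕ) (β : ℝ) (f : ℕ → ℕ → ℝ) (x : ℕ → ℕ) (h0 : x 0 = 0) :
    CL τ β f x = CU τ β f x + β * x τ := by
  have key : ∑ t ∈ Finset.Icc 1 τ, max ((x t : ℝ) - (x (t - 1) : ℝ)) 0
      = ∑ t ∈ Finset.Icc 1 τ, max ((x (t - 1) : ℝ) - (x t : ℝ)) 0 + x τ := by
    induction τ with
    | zero => simp [h0]
    | succ k ih =>
      rw [Finset.sum_Icc_succ_top (by omega), Finset.sum_Icc_succ_top (by omega), ih,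
        Nat.add_sub_cancel]
      grind
  rw [CL, CU, key]
  ring

theorem CL_nonneg {τ m : ℕ} {β : ℝ} (hβ : 0 ≤ β) {f : ℕ → ℕ → ℝ}
    (hnonneg : ∀ t ∈ Finset.Icc 1 τ, ∀ j : ℕ, j ≤ m → 0 ≤ f t j)
    {x : ℕ → ℕ} (hx : Feas τ m x) : 0 ≤ CL τ β f x :=
  add_nonneg (Finset.sum_nonneg fun t ht => hnonneg t ht _ (hx.2 t ht))
    (mul_nonneg hβ (Finset.sum_nonneg fun _ _ => le_max_right _ _))

theorem hatCL_le {τ m : ℕ} {β : ℝ} (hβ : 0 ≤ β) {f : ℕ → ℕ → ℝ}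
    (hnonneg : ∀ t ∈ Finset.Icc 1 τ, ∀ j : ℕ, j ≤ m → 0 ≤ f t j)
    {x : ℕ → ℕ} (hx : Feas τ m x) : hatCL τ m β f (x τ) ≤ CL τ β f x := by
  refine csInf_le ⟨0, ?_⟩ ⟨x, hx, rfl, rfl⟩
  rintro c ⟨y, hy, -, rfl⟩
  exact CL_nonneg hβ hnonneg hy

theorem le_hatCL {τ m n : ℕ} (hτ : 1 ≤ τ) (hn : n ≤ m) {β c : ℝ} {f : ℕ → ℕ → ℝ}
    (h : ∀ x : ℕ → ℕ, Feas τ m x → x τ = n → c ≤ CL τ β f x) : c ≤ hatCL τ m β f n := by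
  refine le_csInf ⟨_, fun t => if t = 0 then 0 else n, ⟨rfl, fun t _ => ?_⟩,
    if_neg (by omega), rfl⟩ ?_
  · dsimp only
    split_ifs <;> omega
  · rintro _ ⟨x, hx, hxn, rfl⟩
    exact h x hx hxn

/-- Translation submodularity of a discretely convex function. -/
theorem add_le_add_of_discrete_convex {m : ℕ} {g : ℕ → ℝ}
    (hg : ∀ a b : ℕ, a ≤ b → b + 1 ≤ m → g (a + 1) - g a ≤ g (b + 1) - g b)
    {a b : ℕ} (hb : b ≤ m) :
    g (min (a + 1) b) + g (max a (b - 1)) ≤ g a + g b := by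
  rcases Nat.lt_or_ge a b with h | h
  · obtain ⟨c, rfl⟩ : ∃ c, b = c + 1 := ⟨b - 1, by omega⟩
    have := hg a c (by omega) hb
    rw [min_eq_left (by omega), Nat.add_sub_cancel, max_eq_right (by omega)]
    linarith
  · rw [min_eq_right (by omega), max_eq_left (by omega), add_comm]

/-- Translation submodularity of the switching cost. -/
theorem switching_translation_submodular (a b c d : ℕ) :
    max (((min (a + 1) c : ℕ) : ℝ) - (min (b + 1) d : ℕ)) 0
      + max (((max a (c - 1) : ℕ) : ℝ) - (max b (d - 1) : ℕ)) 0
      ≤ max ((a : ℝ) - b) 0 + max ((c : ℝ) - d) 0 := by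
  have hmax (u v : ℕ) : ((max u (v - 1) : ℕ) : ℝ) = max ((u : ℝ) + 1) v - 1 := by
    rw [eq_sub_iff_add_eq]
    exact_mod_cast (by omega : max u (v - 1) + 1 = max (u + 1) v)
  rw [hmax, hmax]
  push_cast
  grind

/-- Translation submodularity of `CU`. -/
theorem CU_translation_submodular {τ m : ℕ} {β : ℝ} (hβ : 0 ≤ β) {f : ℕ → ℕ → ℝ}
    (hconv : ∀ t ∈ Finset.Icc 1 τ, ∀ a b : ℕ, a ≤ b → b + 1 ≤ m →
      f t (a + 1) - f t a ≤ f t (b + 1) - f t b)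
    (x : ℕ → ℕ) {y : ℕ → ℕ} (hy : Feas τ m y) :
    CU τ β f (fun t => min (x t + 1) (y t)) + CU τ β f (fun t => max (x t) (y t - 1))
      ≤ CU τ β f x + CU τ β f y := by
  have hf := Finset.sum_le_sum fun t ht =>
    add_le_add_of_discrete_convex (hconv t ht) (a := x t) (hy.2 t ht)
  have hs := mul_le_mul_of_nonneg_left (Finset.sum_le_sum fun t (_ : t ∈ Finset.Icc 1 τ) =>
    switching_translation_submodular (x (t - 1)) (x t) (y (t - 1)) (y t)) hβ
  simp only [Finset.sum_add_distrib, mul_add] at hf hs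
  simp only [CU]
  linarith

/-- For every `τ ∈ {1,…,T}`: if `x^U_τ ≥ 1` then
`Ĉ^L_τ(x^U_τ) − Ĉ^L_τ(x^U_τ − 1) ≤ β`; if `x^U_τ + 1 ≤ m` then
`Ĉ^L_τ(x^U_τ + 1) − Ĉ^L_τ(x^U_τ) ≥ β`; consequently
`Ĉ^L_τ(x) − Ĉ^L_τ(x − 1) ≤ β` for all `1 ≤ x ≤ x^U_τ`. -/
theorem stmt7 (T m : ℕ) (β : ℝ) (hβ : 0 < β)
    (f : ℕ → ℕ → ℝ)
    (hconv : ∀ t ∈ Finset.Icc 1 T, ∀ a b : ℕ, a ≤ b → b + 1 ≤ m →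
      f t (a + 1) - f t a ≤ f t (b + 1) - f t b)
    (hnonneg : ∀ t ∈ Finset.Icc 1 T, ∀ j : ℕ, j ≤ m → 0 ≤ f t j)
    (xU : ℕ → ℕ)
    (hxU : ∀ τ ∈ Finset.Icc 1 T, IsGreatest (FinalU τ m β f) (xU τ)) :
    ∀ τ ∈ Finset.Icc 1 T,
      (1 ≤ xU τ → hatCL τ m β f (xU τ) - hatCL τ m β f (xU τ - 1) ≤ β) ∧
      (xU τ + 1 ≤ m → β ≤ hatCL τ m β f (xU τ + 1) - hatCL τ m β f (xU τ)) ∧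
      (∀ n : ℕ, 1 ≤ n → n ≤ xU τ →
        hatCL τ m β f n - hatCL τ m β f (n - 1) ≤ β) := by
  intro τ hτ
  obtain ⟨hτ1, hτT⟩ := Finset.mem_Icc.1 hτ
  have hsub : Finset.Icc 1 τ ⊆ Finset.Icc 1 T := Finset.Icc_subset_Icc_right hτT
  have hnonneg' := fun t ht => hnonneg t (hsub ht)
  obtain ⟨y, hy, hyU, hmin⟩ := (hxU τ hτ).1
  have hUm : xU τ ≤ m := hyU ▸ hy.2 τ (Finset.right_mem_Icc.2 hτ1)
  have hdiff : ∀ n : ℕ, 1 ≤ n → n ≤ xU τ →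
      hatCL τ m β f n - hatCL τ m β f (n - 1) ≤ β := by
    intro n hn1 hnU
    rw [sub_le_comm]
    refine le_hatCL hτ1 (by omega) fun x hx hxn => ?_
    have hsm := CU_translation_submodular hβ.le (fun t ht => hconv t (hsub ht)) x hy
    have hz : Feas τ m (fun t => min (x t + 1) (y t)) :=
      ⟨by simp [hy.1], fun t ht => (min_le_right _ _).trans (hy.2 t ht)⟩
    have hw : Feas τ m (fun t => max (x t) (y t - 1)) :=
      ⟨by simp [hx.1, hy.1],
        fun t ht => max_le (hx.2 t ht) ((Nat.sub_le _ _).trans (hy.2 t ht))⟩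
    have hzn : min (x τ + 1) (y τ) = n := by omega
    have hle := hatCL_le hβ.le hnonneg' hz
    rw [CL_eq_CU_add _ _ _ _ hz.1] at hle
    simp only [hzn] at hle
    have hx1 : (x τ : ℝ) + 1 = n := by exact_mod_cast (by omega : x τ + 1 = n)
    rw [CL_eq_CU_add _ _ _ _ hx.1]
    rw [← hx1] at hle
    linarith [hmin _ hw]
  refine ⟨fun h => hdiff _ h le_rfl, fun h => ?_, hdiff⟩
  rw [le_sub_iff_add_le]
  refine le_hatCL hτ1 h fun x hx hxn => ?_
  have hle := hatCL_le hβ.le hnonneg' hy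
  rw [CL_eq_CU_add _ _ _ _ hy.1, hyU] at hle
  rw [CL_eq_CU_add _ _ _ _ hx.1, hxn]
  push_cast
  linarith [hmin x hx]
end
end

section
/- Define a schedule X̂ = (x̂_1,…,x̂_T) backwards in time by x̂_{T+1} = 0 and x̂_t = [x̂_{t+1}]_{x^L_t}^{x^U_t} for t = T, T−1, …, 1, where [x]_a^b = max(a, min(b, x)). Then X̂ is an optimal schedule for the discrete data-center optimization problem, i.e. C(X̂) = min over all schedules X of C(X). -/
open Finset

noncomputable section

/-- The clamping `[x]_a^b = max(a, min(b, x))`. -/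
def clamp (a b x : ℕ) : ℕ := max a (min b x)

/-- The value of `V y + β (x - y)⁺` at the clamped point `y = [x]_a^b`. -/
def clampCost (β : ℝ) (V : ℕ → ℝ) (a b x : ℕ) : ℝ :=
  V (clamp a b x) + β * max ((x : ℝ) - (clamp a b x : ℝ)) 0

lemma clampCost_of_le {β : ℝ} {V : ℕ → ℝ} {a b x : ℕ} (h : x ≤ a) :
    clampCost β V a b x = V a := by
  have hc : clamp a b x = a := by unfold clamp; omega
  have hx : (x : ℝ) ≤ a := by exact_mod_cast h
  rw [clampCost, hc, max_eq_right (by linarith)]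
  ring

lemma clampCost_of_mem {β : ℝ} {V : ℕ → ℝ} {a b x : ℕ} (ha : a ≤ x) (hb : x ≤ b) :
    clampCost β V a b x = V x := by
  have hc : clamp a b x = x := by unfold clamp; omega
  rw [clampCost, hc, max_eq_right (by linarith)]
  ring

lemma clampCost_of_ge {β : ℝ} {V : ℕ → ℝ} {a b x : ℕ} (h : b ≤ x) (hab : a ≤ b) :
    clampCost β V a b x = V b + β * ((x : ℝ) - b) := by
  have hc : clamp a b x = b := by unfold clamp; omega
  have hx : (b : ℝ) ≤ x := by exact_mod_cast h
  rw [clampCost, hc, max_eq_left (by linarith)]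

lemma le_of_minimizers {β : ℝ} (hβ : 0 < β) {V : ℕ → ℝ} {a b : ℕ}
    (hab : V a ≤ V b) (hba : V b - β * b ≤ V a - β * a) : a ≤ b := by
  by_contra! h
  have h' : (b : ℝ) < a := by exact_mod_cast h
  nlinarith [mul_pos hβ (sub_pos.2 h')]

section ClampCost

variable {β : ℝ} {V : ℕ → ℝ} {m a b : ℕ}

lemma slope_nonneg_of_minimizer
    (hV : ∀ i j : ℕ, i ≤ j → j + 1 ≤ m → V (i + 1) - V i ≤ V (j + 1) - V j)
    (hmin : ∀ x ≤ m, V a ≤ V x) {k : ℕ} (hk : a ≤ k) (hkm : k + 1 ≤ m) :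
    0 ≤ V (k + 1) - V k := by
  have h₁ := hV a k hk hkm
  have h₂ := hmin (a + 1) (by omega)
  linarith

lemma slope_le_of_minimizer
    (hV : ∀ i j : ℕ, i ≤ j → j + 1 ≤ m → V (i + 1) - V i ≤ V (j + 1) - V j)
    (hb : b ≤ m) (hmin : ∀ x ≤ m, V b - β * b ≤ V x - β * x) {k : ℕ} (hk : k < b) :
    V (k + 1) - V k ≤ β := by
  obtain ⟨c, rfl⟩ : ∃ c, b = c + 1 := ⟨b - 1, by omega⟩
  have h₁ := hV k c (by omega) hb
  have h₂ := hmin c (by omega)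
  push_cast at h₂
  linarith

lemma clampCost_slope_mem
    (hβ : 0 < β) (hV : ∀ i j : ℕ, i ≤ j → j + 1 ≤ m → V (i + 1) - V i ≤ V (j + 1) - V j)
    (hb : b ≤ m) (hab : a ≤ b) (hmina : ∀ x ≤ m, V a ≤ V x)
    (hminb : ∀ x ≤ m, V b - β * b ≤ V x - β * x) (k : ℕ) :
    0 ≤ clampCost β V a b (k + 1) - clampCost β V a b k ∧
      clampCost β V a b (k + 1) - clampCost β V a b k ≤ β := by
  rcases lt_or_ge k a with hka | hka
  · rw [clampCost_of_le hka, clampCost_of_le hka.le]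
    constructor <;> linarith
  rcases lt_or_ge k b with hkb | hkb
  · rw [clampCost_of_mem (by omega) hkb, clampCost_of_mem hka hkb.le]
    exact ⟨slope_nonneg_of_minimizer hV hmina hka (by omega),
      slope_le_of_minimizer hV hb hminb hkb⟩
  · rw [clampCost_of_ge (by omega) hab, clampCost_of_ge hkb hab]
    push_cast
    constructor <;> linarith

lemma clampCost_convex
    (hβ : 0 < β) (hV : ∀ i j : ℕ, i ≤ j → j + 1 ≤ m → V (i + 1) - V i ≤ V (j + 1) - V j)
    (hb : b ≤ m) (hab : a ≤ b) (hmina : ∀ x ≤ m, V a ≤ V x)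
    (hminb : ∀ x ≤ m, V b - β * b ≤ V x - β * x) {i j : ℕ} (hij : i ≤ j) :
    clampCost β V a b (i + 1) - clampCost β V a b i ≤
      clampCost β V a b (j + 1) - clampCost β V a b j := by
  have hi := (clampCost_slope_mem hβ hV hb hab hmina hminb i).2
  have hj := (clampCost_slope_mem hβ hV hb hab hmina hminb j).1
  rcases lt_or_ge i a with hia | hia
  · rwa [clampCost_of_le (x := i + 1) hia, clampCost_of_le (x := i) hia.le, sub_self]
  rcases lt_or_ge j b with hjb | hjb
  · rw [clampCost_of_mem (x := i + 1) (by omega) (by omega),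
      clampCost_of_mem (x := i) hia (by omega),
      clampCost_of_mem (x := j + 1) (by omega) hjb,
      clampCost_of_mem (x := j) (by omega) hjb.le]
    exact hV i j hij (by omega)
  · rw [clampCost_of_ge (x := j + 1) (by omega) hab, clampCost_of_ge (x := j) hjb hab]
    push_cast
    linarith

lemma clampCost_le_self (hab : a ≤ b) (hmina : ∀ x ≤ m, V a ≤ V x)
    (hminb : ∀ x ≤ m, V b - β * b ≤ V x - β * x) {y : ℕ} (hy : y ≤ m) :
    clampCost β V a b y ≤ V y := by
  rcases lt_or_ge y a with hya | hya
  · rw [clampCost_of_le hya.le]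
    exact hmina y hy
  rcases lt_or_ge y b with hyb | hyb
  · rw [clampCost_of_mem hya hyb.le]
  · rw [clampCost_of_ge hyb hab]
    linarith [hminb y hy]

/-- The clamped point minimizes `y ↦ V y + β (x - y)⁺`. -/
lemma clampCost_le
    (hβ : 0 < β) (hV : ∀ i j : ℕ, i ≤ j → j + 1 ≤ m → V (i + 1) - V i ≤ V (j + 1) - V j)
    (hb : b ≤ m) (hab : a ≤ b) (hmina : ∀ x ≤ m, V a ≤ V x)
    (hminb : ∀ x ≤ m, V b - β * b ≤ V x - β * x) (x : ℕ) {y : ℕ} (hy : y ≤ m) :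
    clampCost β V a b x ≤ V y + β * max ((x : ℝ) - y) 0 := by
  have hs := clampCost_slope_mem hβ hV hb hab hmina hminb
  have hself := clampCost_le_self hab hmina hminb hy
  rcases le_total x y with hxy | hxy
  · have hmono : Monotone (clampCost β V a b) :=
      monotone_nat_of_le_succ fun k => by linarith [(hs k).1]
    have := hmono hxy
    have := mul_nonneg hβ.le (le_max_right ((x : ℝ) - y) 0)
    linarith
  · have hanti : Antitone fun k : ℕ => clampCost β V a b k - β * k :=
      antitone_nat_of_succ_le fun k => by
        have := (hs k).2
        push_cast
        linarith
    have h₁ := hanti hxy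
    have h₂ := mul_le_mul_of_nonneg_left (le_max_left ((x : ℝ) - y) 0) hβ.le
    simp only at h₁
    linarith

end ClampCost

/-- The cost-to-arrive: the least cost of serving the first `t` periods and then powering up to
`x` servers, as computed by clamping to `[xL s, xU s]` at every period `s`. -/
def arrivalCost (β : ℝ) (f : ℕ → ℕ → ℝ) (xL xU : ℕ → ℕ) : ℕ → ℕ → ℝ
  | 0 => fun x => β * x
  | t + 1 => clampCost β (fun y => f (t + 1) y + arrivalCost β f xL xU t y)
      (xL (t + 1)) (xU (t + 1))

lemma CL_succ (t : ℕ) (β : ℝ) (f : ℕ → ℕ → ℝ) (x : ℕ → ℕ) :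
    CL (t + 1) β f x =
      CL t β f x + f (t + 1) (x (t + 1)) + β * max ((x (t + 1) : ℝ) - (x t : ℝ)) 0 := by
  simp only [CL, Finset.sum_Icc_succ_top (Nat.le_add_left 1 t), Nat.add_sub_cancel]
  ring

lemma CU_succ (t : ℕ) (β : ℝ) (f : ℕ → ℕ → ℝ) (x : ℕ → ℕ) :
    CU (t + 1) β f x =
      CU t β f x + f (t + 1) (x (t + 1)) + β * max ((x t : ℝ) - (x (t + 1) : ℝ)) 0 := by
  simp only [CU, Finset.sum_Icc_succ_top (Nat.le_add_left 1 t), Nat.add_sub_cancel]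
  ring

lemma CL_zero (β : ℝ) (f : ℕ → ℕ → ℝ) (x : ℕ → ℕ) : CL 0 β f x = 0 := by
  simp [CL]

lemma CU_eq_CL_sub (t : ℕ) (β : ℝ) (f : ℕ → ℕ → ℝ) {x : ℕ → ℕ} (hx : x 0 = 0) :
    CU t β f x = CL t β f x - β * x t := by
  induction t with
  | zero => simp [CU, CL, hx]
  | succ t ih =>
    rw [CU_succ, CL_succ, ih]
    rcases le_total (x t : ℝ) (x (t + 1)) with h | h
    · rw [max_eq_right (by linarith), max_eq_left (by linarith)]
      ring
    · rw [max_eq_left (by linarith), max_eq_right (by linarith)]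
      ring

lemma CL_congr {t : ℕ} {β : ℝ} {f : ℕ → ℕ → ℝ} {x y : ℕ → ℕ} (h : ∀ s ≤ t, x s = y s) :
    CL t β f x = CL t β f y := by
  induction t with
  | zero => rw [CL_zero, CL_zero]
  | succ t ih =>
    rw [CL_succ, CL_succ, ih fun s hs => h s (by omega), h (t + 1) le_rfl, h t (by omega)]

lemma Feas.mono {s t m : ℕ} {x : ℕ → ℕ} (h : Feas t m x) (hst : s ≤ t) : Feas s m x :=
  ⟨h.1, fun r hr => h.2 r (Finset.Icc_subset_Icc_right hst hr)⟩

lemma Feas.le {t m : ℕ} {x : ℕ → ℕ} (h : Feas t m x) : x t ≤ m := by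
  rcases Nat.eq_zero_or_pos t with rfl | ht
  · simp [h.1]
  · exact h.2 t (Finset.mem_Icc.2 ⟨ht, le_rfl⟩)

lemma Feas.update {t m v : ℕ} {x : ℕ → ℕ} (h : Feas t m x) (hv : v ≤ m) :
    Feas (t + 1) m (Function.update x (t + 1) v) := by
  refine ⟨by rw [Function.update_of_ne (by omega), h.1], fun s hs => ?_⟩
  rw [Finset.mem_Icc] at hs
  rcases eq_or_ne s (t + 1) with rfl | hne
  · simpa using hv
  · rw [Function.update_of_ne hne]
    exact h.2 s (Finset.mem_Icc.2 ⟨hs.1, by omega⟩)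

/-- `W x` is the least value of `C^L_t(y) + β (x - y_t)⁺` over feasible `y`, for each `x ≤ m`. -/
def IsArrivalCost (t m : ℕ) (β : ℝ) (f : ℕ → ℕ → ℝ) (W : ℕ → ℝ) : Prop :=
  ∀ x ≤ m, (∀ y, Feas t m y → W x ≤ CL t β f y + β * max ((x : ℝ) - (y t : ℝ)) 0) ∧
    ∃ y, Feas t m y ∧ CL t β f y + β * max ((x : ℝ) - (y t : ℝ)) 0 = W x

section IsArrivalCost

variable {t m : ℕ} {β : ℝ} {f : ℕ → ℕ → ℝ} {W : ℕ → ℝ}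

lemma IsArrivalCost.le_CL (hW : IsArrivalCost t m β f W) {y : ℕ → ℕ} (hy : Feas (t + 1) m y) :
    f (t + 1) (y (t + 1)) + W (y (t + 1)) ≤ CL (t + 1) β f y := by
  rw [CL_succ]
  linarith [(hW _ hy.le).1 y (hy.mono t.le_succ)]

lemma IsArrivalCost.exists_CL_eq (hW : IsArrivalCost t m β f W) {x : ℕ} (hx : x ≤ m) :
    ∃ y, Feas (t + 1) m y ∧ y (t + 1) = x ∧ CL (t + 1) β f y = f (t + 1) x + W x := by
  obtain ⟨y, hy, hyW⟩ := (hW x hx).2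
  refine ⟨Function.update y (t + 1) x, hy.update hx, by simp, ?_⟩
  rw [CL_succ, CL_congr (y := y) fun s hs => Function.update_of_ne (by omega) _ _,
    Function.update_self, Function.update_of_ne (by omega)]
  linarith

lemma IsArrivalCost.minimizer_of_mem_FinalL (hW : IsArrivalCost t m β f W) {a : ℕ}
    (ha : a ∈ FinalL (t + 1) m β f) :
    a ≤ m ∧ ∀ x ≤ m, f (t + 1) a + W a ≤ f (t + 1) x + W x := by
  obtain ⟨z, hz, rfl, hmin⟩ := ha
  refine ⟨hz.le, fun x hx => ?_⟩
  obtain ⟨y, hy, -, hyc⟩ := hW.exists_CL_eq hx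
  linarith [hmin y hy, hW.le_CL hz]

lemma IsArrivalCost.minimizer_of_mem_FinalU (hW : IsArrivalCost t m β f W) {b : ℕ}
    (hb : b ∈ FinalU (t + 1) m β f) :
    b ≤ m ∧ ∀ x ≤ m, f (t + 1) b + W b - β * b ≤ f (t + 1) x + W x - β * x := by
  obtain ⟨z, hz, rfl, hmin⟩ := hb
  refine ⟨hz.le, fun x hx => ?_⟩
  obtain ⟨y, hy, rfl, hyc⟩ := hW.exists_CL_eq hx
  have h := hmin y hy
  rw [CU_eq_CL_sub _ _ _ hz.1, CU_eq_CL_sub _ _ _ hy.1] at h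
  linarith [hW.le_CL hz]

lemma IsArrivalCost.succ (hβ : 0 < β) (hW : IsArrivalCost t m β f W)
    (hWconv : ∀ i j : ℕ, i ≤ j → W (i + 1) - W i ≤ W (j + 1) - W j)
    (hf : ∀ i j : ℕ, i ≤ j → j + 1 ≤ m →
      f (t + 1) (i + 1) - f (t + 1) i ≤ f (t + 1) (j + 1) - f (t + 1) j)
    {a b : ℕ} (ha : a ∈ FinalL (t + 1) m β f) (hb : b ∈ FinalU (t + 1) m β f) :
    IsArrivalCost (t + 1) m β f (clampCost β (fun y => f (t + 1) y + W y) a b) ∧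
      ∀ i j : ℕ, i ≤ j →
        clampCost β (fun y => f (t + 1) y + W y) a b (i + 1) -
            clampCost β (fun y => f (t + 1) y + W y) a b i ≤
          clampCost β (fun y => f (t + 1) y + W y) a b (j + 1) -
            clampCost β (fun y => f (t + 1) y + W y) a b j := by
  obtain ⟨ham, hmina⟩ := hW.minimizer_of_mem_FinalL ha
  obtain ⟨hbm, hminb⟩ := hW.minimizer_of_mem_FinalU hb
  set V : ℕ → ℝ := fun y => f (t + 1) y + W y with hVdef
  have hV : ∀ i j : ℕ, i ≤ j → j + 1 ≤ m → V (i + 1) - V i ≤ V (j + 1) - V j :=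
    fun i j hij hj => by
      simp only [hVdef]
      linarith [hf i j hij hj, hWconv i j hij]
  have hab : a ≤ b := le_of_minimizers (V := V) hβ (hmina b hbm) (hminb a ham)
  refine ⟨fun x hx => ⟨fun y hy => ?_, ?_⟩,
    fun i j hij => clampCost_convex hβ hV hbm hab hmina hminb hij⟩
  · linarith [clampCost_le hβ hV hbm hab hmina hminb x hy.le, hW.le_CL hy]
  · have hc : clamp a b x ≤ m := by unfold clamp; omega
    obtain ⟨y, hy, hyc, hcost⟩ := hW.exists_CL_eq hc
    exact ⟨y, hy, by rw [hcost, hyc, clampCost]⟩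

end IsArrivalCost

lemma isArrivalCost_arrivalCost {T m : ℕ} {β : ℝ} (hβ : 0 < β) {f : ℕ → ℕ → ℝ}
    (hconv : ∀ t ∈ Finset.Icc 1 T, ∀ a b : ℕ, a ≤ b → b + 1 ≤ m →
      f t (a + 1) - f t a ≤ f t (b + 1) - f t b)
    {xL xU : ℕ → ℕ} (hxL : ∀ τ ∈ Finset.Icc 1 T, xL τ ∈ FinalL τ m β f)
    (hxU : ∀ τ ∈ Finset.Icc 1 T, xU τ ∈ FinalU τ m β f) {t : ℕ} (ht : t ≤ T) :
    IsArrivalCost t m β f (arrivalCost β f xL xU t) ∧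
      ∀ i j : ℕ, i ≤ j → arrivalCost β f xL xU t (i + 1) - arrivalCost β f xL xU t i ≤
        arrivalCost β f xL xU t (j + 1) - arrivalCost β f xL xU t j := by
  induction t with
  | zero =>
    refine ⟨fun x _ => ⟨fun y hy => ?_, fun _ => 0, ⟨rfl, by simp⟩, ?_⟩, fun i j _ => ?_⟩
    · simp [arrivalCost, CL_zero, hy.1]
    · simp [arrivalCost, CL_zero]
    · simp only [arrivalCost]
      push_cast
      linarith
  | succ t ih =>
    have hmem : t + 1 ∈ Finset.Icc 1 T := Finset.mem_Icc.2 ⟨by omega, ht⟩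
    obtain ⟨hW, hWconv⟩ := ih (by omega)
    exact hW.succ hβ hWconv (hconv _ hmem) (hxL _ hmem) (hxU _ hmem)

lemma CL_add_eq_arrivalCost {T : ℕ} {β : ℝ} {f : ℕ → ℕ → ℝ} {xL xU x : ℕ → ℕ} (h0 : x 0 = 0)
    (hrec : ∀ t ∈ Finset.Icc 1 T, x t = clamp (xL t) (xU t) (x (t + 1))) {t : ℕ} (ht : t ≤ T) :
    CL t β f x + β * max ((x (t + 1) : ℝ) - (x t : ℝ)) 0 =
      arrivalCost β f xL xU t (x (t + 1)) := by
  induction t with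
  | zero => simp [CL_zero, arrivalCost, h0]
  | succ t ih =>
    rw [arrivalCost, clampCost, ← hrec (t + 1) (Finset.mem_Icc.2 ⟨by omega, ht⟩), CL_succ,
      ← ih (by omega)]
    ring

/-- The schedule defined backwards by `x̂_{T+1} = 0` and
`x̂_t = [x̂_{t+1}]_{x^L_t}^{x^U_t}` (clamping, `[x]_a^b = max(a, min(b, x))`) is an
optimal schedule for the discrete data-center optimization problem. -/
theorem stmt8 (T m : ℕ) (β : ℝ) (hβ : 0 < β)
    (f : ℕ → ℕ → ℝ)
    (hconv : ∀ t ∈ Finset.Icc 1 T, ∀ a b : ℕ, a ≤ b → b + 1 ≤ m →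
      f t (a + 1) - f t a ≤ f t (b + 1) - f t b)
    (hnonneg : ∀ t ∈ Finset.Icc 1 T, ∀ j : ℕ, j ≤ m → 0 ≤ f t j)
    (xL xU : ℕ → ℕ)
    (hxL : ∀ τ ∈ Finset.Icc 1 T, IsLeast (FinalL τ m β f) (xL τ))
    (hxU : ∀ τ ∈ Finset.Icc 1 T, IsGreatest (FinalU τ m β f) (xU τ))
    (xhat : ℕ → ℕ) (h0 : xhat 0 = 0) (hT1 : xhat (T + 1) = 0)
    (hrec : ∀ t ∈ Finset.Icc 1 T, xhat t = max (xL t) (min (xU t) (xhat (t + 1)))) :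
    Feas T m xhat ∧ ∀ y : ℕ → ℕ, Feas T m y → CL T β f xhat ≤ CL T β f y := by
  have hL : ∀ τ ∈ Finset.Icc 1 T, xL τ ∈ FinalL τ m β f := fun τ hτ => (hxL τ hτ).1
  have hU : ∀ τ ∈ Finset.Icc 1 T, xU τ ∈ FinalU τ m β f := fun τ hτ => (hxU τ hτ).1
  refine ⟨⟨h0, fun t ht => ?_⟩, fun y hy => ?_⟩
  · obtain ⟨z, hz, hzL, -⟩ := hL t ht
    obtain ⟨w, hw, hwU, -⟩ := hU t ht
    have := hz.le
    have := hw.le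
    rw [hrec t ht]
    omega
  · obtain ⟨hW, -⟩ := isArrivalCost_arrivalCost hβ hconv hL hU le_rfl
    have h₁ := (hW 0 m.zero_le).1 y hy
    have h₂ := CL_add_eq_arrivalCost (β := β) (f := f) h0 hrec le_rfl
    rw [hT1] at h₂
    have hneg : ∀ n : ℕ, max (((0 : ℕ) : ℝ) - (n : ℝ)) 0 = 0 := fun n =>
      max_eq_right (by simp)
    rw [hneg, mul_zero, add_zero] at h₁ h₂
    exact h₂.trans_le h₁
end
end
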